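/- Let τ > 0 and ω > 0. The delay cosine function t ↦ cos_τ(ω,t) is differentiable at every t ∈ (-τ, ∞), and its derivative satisfies d/dt cos_τ(ω,t) = -ω sin_τ(ω, t - τ) for all t ∈ (-τ, ∞). -/

import Mathlib

open Real Set Filter Topology MeasureTheory

/-- `C` is the delay cosine function `cos_τ(ω, ·)`: it vanishes for `t < -τ` and, for every
integer `k ≥ 0` and `(k-1)τ ≤ t < kτ`, equals
`∑_{j=0}^{k} (-1)^j ω^(2j) (t-(j-1)τ)^(2j) / (2j)!`. -/
def IsDelayCos (τ ω : ℝ) (C : ℝ → ℝ) : Prop :=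
  (∀ t : ℝ, t < -τ → C t = 0) ∧
  ∀ (k : ℕ) (t : ℝ), ((k : ℝ) - 1) * τ ≤ t → t < (k : ℝ) * τ →
    C t = ∑ j ∈ Finset.range (k + 1),
      (-1 : ℝ) ^ j * ω ^ (2 * j) * (t - ((j : ℝ) - 1) * τ) ^ (2 * j) / ((2 * j).factorial : ℝ)

/-- `S` is the delay sine function `sin_τ(ω, ·)`: it vanishes for `t < -τ` and, for every
integer `k ≥ 0` and `(k-1)τ ≤ t < kτ`, equals
`∑_{j=0}^{k} (-1)^j ω^(2j+1) (t-(j-1)τ)^(2j+1) / (2j+1)!`. -/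
def IsDelaySin (τ ω : ℝ) (S : ℝ → ℝ) : Prop :=
  (∀ t : ℝ, t < -τ → S t = 0) ∧
  ∀ (k : ℕ) (t : ℝ), ((k : ℝ) - 1) * τ ≤ t → t < (k : ℝ) * τ →
    S t = ∑ j ∈ Finset.range (k + 1),
      (-1 : ℝ) ^ j * ω ^ (2 * j + 1) * (t - ((j : ℝ) - 1) * τ) ^ (2 * j + 1) / ((2 * j + 1).factorial : ℝ)

/-- The positive part raised to a power at least two is differentiable. -/
theorem hasDerivAt_max_zero_pow (n : ℕ) (x : ℝ) :
    HasDerivAt (fun y : ℝ => max y 0 ^ (n + 2)) (((n + 2 : ℕ) : ℝ) * max x 0 ^ (n + 1)) x := by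
  have hpow : HasDerivAt (fun y : ℝ => y ^ (n + 2)) (((n + 2 : ℕ) : ℝ) * x ^ (n + 1)) x := by
    simpa using hasDerivAt_pow (n + 2) x
  rcases lt_trichotomy x 0 with hx | rfl | hx
  · rw [max_eq_right hx.le]
    simp only [zero_pow (Nat.succ_ne_zero n), mul_zero]
    refine (hasDerivAt_const x (0 : ℝ)).congr_of_eventuallyEq ?_
    filter_upwards [Iio_mem_nhds hx] with y hy
    simp [max_eq_right (Set.mem_Iio.1 hy).le]
  · rw [max_self, ← hasDerivWithinAt_univ, ← Set.Iic_union_Ici (a := (0 : ℝ))]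
    refine HasDerivWithinAt.union ?_ ?_
    · simp only [zero_pow (Nat.succ_ne_zero n), mul_zero]
      refine (hasDerivWithinAt_const (0 : ℝ) _ (0 : ℝ)).congr (fun y hy => ?_) (by simp)
      simp [max_eq_right (Set.mem_Iic.1 hy)]
    · refine hpow.hasDerivWithinAt.congr (fun y hy => ?_) (by simp)
      simp [max_eq_left (Set.mem_Ici.1 hy)]
  · rw [max_eq_left hx.le]
    refine hpow.congr_of_eventuallyEq ?_
    filter_upwards [Ioi_mem_nhds hx] with y hy
    simp [max_eq_left (Set.mem_Ioi.1 hy).le]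

/-- A sum of delayed powers, truncated at the current delay interval, agrees with the sum of the
corresponding positive parts up to any later index. -/
theorem sum_delayed_pow_eq_sum_max {τ : ℝ} (hτ : 0 < τ) (a : ℕ → ℝ) (p : ℕ → ℕ)
    (hp : ∀ j, 1 ≤ j → p j ≠ 0) {k N : ℕ} (hkN : k ≤ N) {t : ℝ}
    (h₁ : ((k : ℝ) - 1) * τ ≤ t) (h₂ : t < k * τ) :
    ∑ j ∈ Finset.range (k + 1), a j * (t - ((j : ℝ) - 1) * τ) ^ p j =
      ∑ j ∈ Finset.range (N + 1), a j * max (t - ((j : ℝ) - 1) * τ) 0 ^ p j := by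
  rw [← Finset.sum_subset (Finset.range_mono (Nat.succ_le_succ hkN))]
  · refine Finset.sum_congr rfl fun j hj => ?_
    have hjk : (j : ℝ) ≤ k := by exact_mod_cast Finset.mem_range_succ_iff.1 hj
    rw [max_eq_left (by nlinarith)]
  · intro j _ hj
    have hkj : k + 1 ≤ j := by simpa using hj
    have hkj' : (k : ℝ) + 1 ≤ j := by exact_mod_cast hkj
    rw [max_eq_right (by nlinarith), zero_pow (hp j (by omega)), mul_zero]

/-- Every real number at least `-τ` lies in one of the delay intervals `[(k-1)τ, kτ)`. -/
theorem exists_delay_interval {τ t : ℝ} (hτ : 0 < τ) (ht : -τ ≤ t) :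
    ∃ k : ℕ, ((k : ℝ) - 1) * τ ≤ t ∧ t < k * τ := by
  have h0 : 0 ≤ (t + τ) / τ := div_nonneg (by linarith) hτ.le
  refine ⟨⌊(t + τ) / τ⌋₊, ?_, ?_⟩
  · have := (le_div_iff₀ hτ).1 (Nat.floor_le h0)
    linarith
  · have := (div_lt_iff₀ hτ).1 (Nat.lt_floor_add_one ((t + τ) / τ))
    linarith

/-- The delay interval of a number below `Nτ` has index at most `N`. -/
theorem exists_delay_interval_le {τ t : ℝ} {N : ℕ} (hτ : 0 < τ) (ht : -τ ≤ t)
    (htN : t < N * τ) : ∃ k ≤ N, ((k : ℝ) - 1) * τ ≤ t ∧ t < k * τ := by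
  obtain ⟨k, h₁, h₂⟩ := exists_delay_interval hτ ht
  have hkN : k ≤ N := by
    have : (k : ℝ) - 1 < N := lt_of_mul_lt_mul_right (h₁.trans_lt htN) hτ.le
    have : (k : ℝ) < (N + 1 : ℕ) := by push_cast; linarith
    exact Nat.lt_succ_iff.1 (by exact_mod_cast this)
  exact ⟨k, hkN, h₁, h₂⟩

/-- On `[-τ, Nτ)` the delay cosine is a single sum of powers of positive parts. -/
theorem IsDelayCos.eq_sum_max {τ ω : ℝ} {C : ℝ → ℝ} (hC : IsDelayCos τ ω C) (hτ : 0 < τ)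
    {N : ℕ} {t : ℝ} (ht : -τ ≤ t) (htN : t < N * τ) :
    C t = ∑ j ∈ Finset.range (N + 1), (-1 : ℝ) ^ j * ω ^ (2 * j) / ((2 * j).factorial : ℝ) *
      max (t - ((j : ℝ) - 1) * τ) 0 ^ (2 * j) := by
  obtain ⟨k, hkN, h₁, h₂⟩ := exists_delay_interval_le hτ ht htN
  rw [hC.2 k t h₁ h₂, ← sum_delayed_pow_eq_sum_max hτ _ (fun j => 2 * j)
    (fun j hj => by omega) hkN h₁ h₂]
  exact Finset.sum_congr rfl fun j _ => by ring

/-- On `(-∞, Nτ)` the delay sine is a single sum of powers of positive parts. -/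
theorem IsDelaySin.eq_sum_max {τ ω : ℝ} {S : ℝ → ℝ} (hS : IsDelaySin τ ω S) (hτ : 0 < τ)
    {N : ℕ} {t : ℝ} (htN : t < N * τ) :
    S t = ∑ j ∈ Finset.range (N + 1),
      (-1 : ℝ) ^ j * ω ^ (2 * j + 1) / ((2 * j + 1).factorial : ℝ) *
        max (t - ((j : ℝ) - 1) * τ) 0 ^ (2 * j + 1) := by
  rcases lt_or_ge t (-τ) with ht | ht
  · rw [hS.1 t ht]
    refine (Finset.sum_eq_zero fun j _ => ?_).symm
    have : 0 ≤ (j : ℝ) * τ := by positivity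
    rw [max_eq_right (by linarith), zero_pow (Nat.succ_ne_zero _), mul_zero]
  obtain ⟨k, hkN, h₁, h₂⟩ := exists_delay_interval_le hτ ht htN
  rw [hS.2 k t h₁ h₂, ← sum_delayed_pow_eq_sum_max hτ _ (fun j => 2 * j + 1)
    (fun j hj => by omega) hkN h₁ h₂]
  exact Finset.sum_congr rfl fun j _ => by ring

/-- **Derivative of the delay cosine** (`τ > 0`, `ω > 0`): the delay cosine `cos_τ(ω,·)` is
differentiable at every `t ∈ (-τ, ∞)` with `d/dt cos_τ(ω,t) = -ω sin_τ(ω, t - τ)`. -/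
theorem delay_cos_hasDerivAt (τ ω : ℝ) (hτ : 0 < τ) (hω : 0 < ω)
    (dc ds : ℝ → ℝ) (hc : IsDelayCos τ ω dc) (hs : IsDelaySin τ ω ds) :
    ∀ t ∈ Set.Ioi (-τ), HasDerivAt dc (-(ω * ds (t - τ))) t := by
  intro t ht
  obtain ⟨k, -, htk⟩ := exists_delay_interval hτ (le_of_lt ht)
  have htN : t < ((k + 1 : ℕ) : ℝ) * τ := by push_cast; linarith
  have heq : dc =ᶠ[𝓝 t] fun y => ∑ j ∈ Finset.range (k + 1 + 1),
      (-1 : ℝ) ^ j * ω ^ (2 * j) / ((2 * j).factorial : ℝ) *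
        max (y - ((j : ℝ) - 1) * τ) 0 ^ (2 * j) := by
    filter_upwards [Ioi_mem_nhds ht, Iio_mem_nhds htN] with y hy hyN
    exact hc.eq_sum_max hτ (le_of_lt hy) hyN
  refine HasDerivAt.congr_of_eventuallyEq ?_ heq
  rw [hs.eq_sum_max (N := k) hτ (by linarith), Finset.mul_sum, ← Finset.sum_neg_distrib]
  simp_rw [Finset.sum_range_succ' _ (k + 1)]
  simp only [mul_zero, pow_zero]
  refine HasDerivAt.add_const _ (HasDerivAt.fun_sum fun j _ => ?_)
  have h := ((hasDerivAt_max_zero_pow (2 * j) (t - (((j + 1 : ℕ) : ℝ) - 1) * τ)).comp t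
    ((hasDerivAt_id t).sub_const ((((j + 1 : ℕ) : ℝ) - 1) * τ))).const_mul
    ((-1 : ℝ) ^ (j + 1) * ω ^ (2 * (j + 1)) / ((2 * (j + 1)).factorial : ℝ))
  refine h.congr_deriv ?_
  have hshift : t - τ - ((j : ℝ) - 1) * τ = t - (((j + 1 : ℕ) : ℝ) - 1) * τ := by
    push_cast; ring
  have hfact : ((2 * (j + 1)).factorial : ℝ) = ((2 * j + 2 : ℕ) : ℝ) * ((2 * j + 1).factorial : ℝ) := by
    rw [← Nat.cast_mul]
    rfl
  have hne : ((2 * j + 2 : ℕ) : ℝ) ≠ 0 := by positivity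
  have hne' : ((2 * j + 1).factorial : ℝ) ≠ 0 := by positivity
  rw [hshift, hfact]
  field_simp
  ring
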